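/- Let G be a finite connected simple graph with a modular partition P = {M_1, …, M_k} into k ≥ 2 modules. Then there exists a poly-star MAD tree T* of G with a root r* ∈ M_{i*} such that deg_G(r*) ≥ deg_G(v) for all v ∈ M_{i*}, i.e., r* has maximum degree in G among the vertices of its module. -/

import Mathlib

open SimpleGraph

/-- The Wiener index of a graph: the sum of distances over all unordered pairs of
vertices (each unordered pair is counted twice in the double sum, hence the division). -/
noncomputable def wiener {V : Type*} [Fintype V] (G : SimpleGraph V) : ℕ :=
  (∑ u : V, ∑ v : V, G.dist u v) / 2

/-- `T` is a spanning tree of `G`. -/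
def IsSpanningTree {V : Type*} (G T : SimpleGraph V) : Prop :=
  T ≤ G ∧ T.IsTree

/-- `T` is a MAD tree of `G`: a spanning tree minimizing the Wiener index among
all spanning trees of `G`. -/
def IsMADTree {V : Type*} [Fintype V] (G T : SimpleGraph V) : Prop :=
  IsSpanningTree G T ∧ ∀ T' : SimpleGraph V, IsSpanningTree G T' → wiener T ≤ wiener T'

/-- A module of `G`: every vertex outside `M` is adjacent to all vertices of `M`
or to none of them. -/
def IsModule {V : Type*} (G : SimpleGraph V) (M : Set V) : Prop :=
  ∀ x ∉ M, (∀ v ∈ M, G.Adj x v) ∨ (∀ v ∈ M, ¬ G.Adj x v)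

/-- A modular partition `M_1, …, M_k` (with `k ≥ 2`) of the vertex set of `G`
into (nonempty, pairwise disjoint, covering) modules. -/
def IsModularPartition {V : Type*} (G : SimpleGraph V) {k : ℕ} (M : Fin k → Set V) : Prop :=
  2 ≤ k ∧ (∀ j, (M j).Nonempty) ∧ (∀ j, IsModule G (M j)) ∧
    (Pairwise fun j j' => Disjoint (M j) (M j')) ∧ (⋃ j, M j) = Set.univ

/-- `r` is a root of the spanning tree `T` of `G`: every path in `T` starting at `r`
is an induced path in `G`, i.e. any two vertices of the path that are adjacent in `G`
are consecutive on the path. -/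
def IsRoot {V : Type*} (G T : SimpleGraph V) (r : V) : Prop :=
  ∀ ⦃v : V⦄ (p : T.Walk r v), p.IsPath →
    ∀ x ∈ p.support, ∀ y ∈ p.support, G.Adj x y → s(x, y) ∈ p.edges

/-- `T` is a poly-star with respect to the partition `M`: every part contains at most
one vertex of degree at least 2 in `T`. -/
def IsPolyStar {V : Type*} (T : SimpleGraph V) {k : ℕ} (M : Fin k → Set V) : Prop :=
  ∀ j : Fin k, ∀ u ∈ M j, ∀ v ∈ M j,
    2 ≤ (T.neighborSet u).ncard → 2 ≤ (T.neighborSet v).ncard → u = v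


namespace MadAux

variable {V : Type*}

lemma adj_cases {T : SimpleGraph V} (hT : T.IsTree) (z : V) {a b : V} (h : T.Adj a b) :
    T.dist z a = T.dist z b + 1 ∨ T.dist z b = T.dist z a + 1 :=
  hT.dist_eq_dist_add_one_of_adj z h

lemma geod_split {T : SimpleGraph V} (hT : T.IsTree) {u v c : V} (p : T.Walk u v)
    (hp : p.length = T.dist u v) (hc : c ∈ p.support) :
    T.dist u v = T.dist u c + T.dist c v := by
  classical
  have h1 : (p.takeUntil c hc).length + (p.dropUntil c hc).length = p.length := by
    rw [← Walk.length_append, Walk.take_spec]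
  have h2 := dist_le (p.takeUntil c hc)
  have h3 := dist_le (p.dropUntil c hc)
  have h4 := hT.connected.dist_triangle (u := u) (v := c) (w := v)
  omega

lemma path_len {T : SimpleGraph V} (hT : T.IsTree) {u v : V} (p : T.Walk u v)
    (hp : p.IsPath) : p.length = T.dist u v := by
  obtain ⟨q, hq, hl⟩ := hT.connected.exists_path_of_dist u v
  have := (hT.isAcyclic.subsingleton_path u v).elim ⟨p, hp⟩ ⟨q, hq⟩
  have h : p = q := congrArg Subtype.val this
  rw [h, hl]

/-- Distances across an edge. -/
lemma cross {T : SimpleGraph V} (hT : T.IsTree) {p y z w : V} (h : T.Adj p y)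
    (hz : T.dist p z = T.dist y z + 1) (hw : T.dist y w = T.dist p w + 1) :
    T.dist z w = T.dist z y + 1 + T.dist p w := by
  obtain ⟨p1, hp1, hl1⟩ := hT.connected.exists_path_of_dist z y
  obtain ⟨p2, hp2, hl2⟩ := hT.connected.exists_path_of_dist p w
  have key1 : ∀ c ∈ p1.support, T.dist p c = T.dist y c + 1 := by
    intro c hc
    have h1 := geod_split hT p1 hl1 hc
    have h2 := hT.connected.dist_triangle (u := z) (v := c) (w := p)
    have h3 := adj_cases hT c h
    have h4 := T.dist_comm (u := z) (v := p)
    have h5 := T.dist_comm (u := z) (v := y)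
    have h6 := T.dist_comm (u := c) (v := p)
    have h7 := T.dist_comm (u := c) (v := y)
    omega
  have key2 : ∀ c ∈ p2.support, T.dist y c = T.dist p c + 1 := by
    intro c hc
    have h1 := geod_split hT p2 hl2 hc
    have h2 := hT.connected.dist_triangle (u := y) (v := c) (w := w)
    have h3 := adj_cases hT c h
    simp only [T.dist_comm (u := c) (v := y), T.dist_comm (u := c) (v := p)] at *
    omega
  have hpath : (p1.append (Walk.cons h.symm p2)).IsPath := by
    rw [Walk.isPath_def, Walk.support_append, Walk.support_cons, List.tail_cons,
      List.nodup_append]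
    refine ⟨hp1.support_nodup, hp2.support_nodup, ?_⟩
    rintro a ha b hb rfl
    have := key1 a ha
    have := key2 a hb
    omega
  have := path_len hT _ hpath
  rw [Walk.length_append, Walk.length_cons] at this
  omega

/-- Two distinct neighbours of `a`: if one is closer to `z`, the other one is farther. -/
lemma other_far {T : SimpleGraph V} (hT : T.IsTree) {a e b z : V} (he : T.Adj a e)
    (hb : T.Adj a b) (hne : e ≠ b) (hz : T.dist z a = T.dist z e + 1) :
    T.dist z b = T.dist z a + 1 := by
  have h0 : T.dist e b = T.dist a b + 1 := by
    have h1 := adj_cases hT b he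
    have h2 : T.dist a b = 1 := dist_eq_one_iff_adj.2 hb
    have h3 := hT.connected.pos_dist_of_ne hne
    simp only [T.dist_comm (u := b)] at *
    omega
  have := cross hT he (z := z) (w := b) (by simpa only [T.dist_comm (v := z)] using hz) h0
  have h2 : T.dist a b = 1 := dist_eq_one_iff_adj.2 hb
  omega

/-- A neighbour towards `z`. -/
lemma exists_parent {T : SimpleGraph V} (hT : T.IsTree) {z u : V} (h : u ≠ z) :
    ∃ e, T.Adj u e ∧ T.dist z u = T.dist z e + 1 := by
  obtain ⟨p, hp⟩ := hT.connected.exists_walk_length_eq_dist u z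
  cases p with
  | nil => exact absurd rfl h
  | @cons _ e _ hadj q =>
    refine ⟨e, hadj, ?_⟩
    have h1 := dist_le q
    have h2 := adj_cases hT z hadj
    rw [Walk.length_cons] at hp
    simp only [T.dist_comm (v := z)] at *
    omega

/-- total distance -/
noncomputable def D [Fintype V] (T : SimpleGraph V) (x : V) : ℕ := ∑ y, T.dist x y

lemma D_convex [Fintype V] {T : SimpleGraph V} (hT : T.IsTree) {a e b : V} (he : T.Adj a e)
    (hb : T.Adj a b) (hne : e ≠ b) : 2 * D T a ≤ D T e + D T b := by
  unfold D
  rw [Finset.mul_sum, ← Finset.sum_add_distrib]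
  apply Finset.sum_le_sum
  intro z _
  have h1 := other_far hT (z := z) he hb hne
  have h2 := other_far hT (z := z) hb he hne.symm
  have h3 := adj_cases hT z he
  have h4 := adj_cases hT z hb
  simp only [T.dist_comm (u := z)] at *
  omega

lemma D_edge [Fintype V] {T : SimpleGraph V} (hT : T.IsTree) {r : V}
    (hr : ∀ x, D T r ≤ D T x) : ∀ (n : ℕ) (a b : V), T.dist r a = n → T.Adj a b →
      T.dist r b = n + 1 → D T a ≤ D T b := by
  intro n
  induction n with
  | zero =>
    intro a b ha _ _
    have : r = a := (hT.connected.dist_eq_zero_iff).1 ha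
    subst this
    exact hr b
  | succ n ih =>
    intro a b ha hab hb
    have hne : a ≠ r := by rintro rfl; simp at ha
    obtain ⟨e, he, hd⟩ := exists_parent hT hne
    have h1 := ih e a (by omega) he.symm ha
    have h2 := D_convex hT he hab (by rintro rfl; omega)
    omega

lemma D_mono [Fintype V] {T : SimpleGraph V} (hT : T.IsTree) {r : V}
    (hr : ∀ x, D T r ≤ D T x) (x : V) : ∀ (n : ℕ) (p : V), T.dist x p = n →
      T.dist r p = T.dist r x + T.dist x p → D T x ≤ D T p := by
  intro n
  induction n with
  | zero =>
    intro p hp _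
    have : x = p := (hT.connected.dist_eq_zero_iff).1 hp
    rw [this]
  | succ n ih =>
    intro p hp h
    have hne : p ≠ x := by rintro rfl; simp at hp
    obtain ⟨e, he, hd⟩ := exists_parent hT hne
    have h1 := hT.connected.dist_triangle (u := r) (v := x) (w := e)
    have h2 := adj_cases hT r he
    have h3 := ih e (by omega) (by omega)
    have h4 := D_edge hT hr _ e p rfl he.symm (by omega)
    omega

/-- `y`-side of the edge `p y`. -/
def half (T : SimpleGraph V) (p y : V) : Set V := {z | T.dist p z = T.dist y z + 1}

/-- `S` is attached at `p`. -/
def Gate (T : SimpleGraph V) (S : Set V) (p : V) : Prop :=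
  p ∉ S ∧ ∀ s ∈ S, ∀ y ∉ S, T.dist s y = T.dist s p + T.dist p y

lemma gate_half {T : SimpleGraph V} (hT : T.IsTree) {p y : V} (h : T.Adj p y) :
    Gate T (half T p y) p := by
  refine ⟨by simp [half], ?_⟩
  intro s hs z hz
  simp only [half, Set.mem_ofPred_eq] at hs hz
  have h1 := adj_cases hT z h
  have h2 := cross hT h hs (w := z) (by simp only [T.dist_comm (u := z)] at *; omega)
  rw [T.dist_comm (u := s) (v := p), hs, h2, T.dist_comm (u := s)]

lemma gate_half' {T : SimpleGraph V} (hT : T.IsTree) {p y : V} (h : T.Adj p y) :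
    Gate T (half T p y \ {y}) y := by
  refine ⟨by simp, ?_⟩
  rintro s ⟨hs, hsy⟩ z hz
  by_cases hzy : z = y
  · subst hzy; simp
  have hz : z ∉ half T p y := fun h => hz ⟨h, hzy⟩
  simp only [half, Set.mem_ofPred_eq] at hs hz
  have h1 := adj_cases hT z h
  have h3 : T.dist y z = T.dist p z + 1 := by simp only [T.dist_comm (u := z)] at *; omega
  have h2 := cross hT h hs h3
  omega

/-- Moving the part `S` attached at `p` to `x`. -/
def move (T : SimpleGraph V) (S : Set V) (p x : V) : SimpleGraph V :=
  SimpleGraph.fromRel fun u v =>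
    (T.Adj u v ∧ (u ∈ S ↔ v ∈ S)) ∨ (u ∈ S ∧ v = x ∧ T.Adj u p)

lemma gate_adj {T : SimpleGraph V} (hT : T.IsTree) {S : Set V} {p : V} (hg : Gate T S p)
    {s y : V} (hs : s ∈ S) (hy : y ∉ S) (h : T.Adj s y) : y = p := by
  have h1 := hg.2 s hs y hy
  have h2 : T.dist s y = 1 := dist_eq_one_iff_adj.2 h
  have h3 : s ≠ p := fun h => hg.1 (h ▸ hs)
  have h4 := hT.connected.pos_dist_of_ne h3
  exact ((hT.connected.dist_eq_zero_iff).1 (by omega : T.dist p y = 0)).symm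

lemma move_out {T : SimpleGraph V} (hT : T.IsTree) {S : Set V} {p x : V} (hg : Gate T S p) :
    ∀ (n : ℕ) (u v : V), u ∉ S → v ∉ S → T.dist u v = n →
      ∃ w : (move T S p x).Walk u v, w.length = n := by
  intro n
  induction n with
  | zero =>
    intro u v _ _ h
    obtain rfl := (hT.connected.dist_eq_zero_iff).1 h
    exact ⟨Walk.nil, rfl⟩
  | succ n ih =>
    intro u v hu hv h
    have hne : u ≠ v := by rintro rfl; simp at h
    obtain ⟨e, he, hd⟩ := exists_parent hT hne
    have heS : e ∉ S := by
      intro heS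
      obtain rfl := gate_adj hT hg heS hu he.symm
      have h2 := hg.2 e heS v hv
      simp only [T.dist_comm (u := v)] at *
      omega
    obtain ⟨w, hw⟩ := ih e v heS hv (by simp only [T.dist_comm (u := v)] at *; omega)
    have hadj : (move T S p x).Adj u e := by
      simp only [move, fromRel_adj]
      exact ⟨he.ne, Or.inl (Or.inl ⟨he, by simp [hu, heS]⟩)⟩
    exact ⟨Walk.cons hadj w, by simp [hw]⟩

open Classical in
lemma move_in {T : SimpleGraph V} (hT : T.IsTree) {S : Set V} {p x : V} (hg : Gate T S p)
    (hx : x ∉ S) :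
    ∀ (n : ℕ) (u v : V), (u ∈ S ∨ u = p) → (v ∈ S ∨ v = p) → T.dist u v = n →
      ∃ w : (move T S p x).Walk (if u = p then x else u) (if v = p then x else v),
        w.length = n := by
  intro n
  induction n with
  | zero =>
    intro u v _ _ h
    obtain rfl := (hT.connected.dist_eq_zero_iff).1 h
    exact ⟨Walk.nil, rfl⟩
  | succ n ih =>
    intro u v hu hv h
    have hne : u ≠ v := by rintro rfl; simp at h
    obtain ⟨e, he, hd⟩ := exists_parent hT hne
    have hpS := hg.1
    have heS : e ∈ S ∨ e = p := by
      by_contra hcon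
      push Not at hcon
      rcases hu with hu | rfl
      · exact hcon.2 (gate_adj hT hg hu hcon.1 he)
      · rcases hv with hv | rfl
        · have h1 := hg.2 v hv e hcon.1
          omega
        · exact hne rfl
    obtain ⟨w, hw⟩ := ih e v heS hv (by simp only [T.dist_comm (u := v)] at *; omega)
    have hadj : (move T S p x).Adj (if u = p then x else u) (if e = p then x else e) := by
      simp only [move, fromRel_adj]
      have hne := he.ne
      rcases hu with hu | rfl
      · have hup : u ≠ p := fun h => hpS (h ▸ hu)
        have hux : u ≠ x := fun h => hx (h ▸ hu)
        rcases heS with heS | rfl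
        · have hep : e ≠ p := fun h => hpS (h ▸ heS)
          rw [if_neg hup, if_neg hep]
          exact ⟨hne, Or.inl (Or.inl ⟨he, by simp [hu, heS]⟩)⟩
        · rw [if_neg hup, if_pos rfl]
          exact ⟨hux, Or.inl (Or.inr ⟨hu, rfl, he⟩)⟩
      · rcases heS with heS | rfl
        · have hep : e ≠ u := fun h => hpS (h ▸ heS)
          have hex : e ≠ x := fun h => hx (h ▸ heS)
          rw [if_neg hep, if_pos rfl]
          exact ⟨hex.symm, Or.inr (Or.inr ⟨heS, rfl, he.symm⟩)⟩
        · exact absurd rfl hne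
    exact ⟨Walk.cons hadj w, by simp [hw]⟩

/-- Walk bounds in the moved tree, all cases. -/
lemma move_cross {T : SimpleGraph V} (hT : T.IsTree) {S : Set V} {p x : V} (hg : Gate T S p)
    (hx : x ∉ S) {s y : V} (hs : s ∈ S) (hy : y ∉ S) :
    ∃ w : (move T S p x).Walk s y, w.length = T.dist s p + T.dist x y := by
  have hsp : s ≠ p := fun h => hg.1 (h ▸ hs)
  obtain ⟨w1, h1⟩ := move_in hT hg hx _ s p (Or.inl hs) (Or.inr rfl) rfl
  obtain ⟨w2, h2⟩ := move_out (x := x) hT hg _ x y hx hy rfl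
  refine ⟨((w1.copy (if_neg hsp) (if_pos rfl)).append w2), ?_⟩
  rw [Walk.length_append, Walk.length_copy, h1, h2]

lemma move_same {T : SimpleGraph V} (hT : T.IsTree) {S : Set V} {p x : V} (hg : Gate T S p)
    (hx : x ∉ S) {u v : V} (h : u ∈ S ↔ v ∈ S) :
    ∃ w : (move T S p x).Walk u v, w.length = T.dist u v := by
  by_cases hu : u ∈ S
  · have hv := h.1 hu
    have hup : u ≠ p := fun h => hg.1 (h ▸ hu)
    have hvp : v ≠ p := fun h => hg.1 (h ▸ hv)
    obtain ⟨w1, h1⟩ := move_in hT hg hx _ u v (Or.inl hu) (Or.inl hv) rfl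
    exact ⟨w1.copy (if_neg hup) (if_neg hvp), by rw [Walk.length_copy, h1]⟩
  · exact move_out hT hg _ u v hu (fun hv => hu (h.2 hv)) rfl

lemma move_connected {T : SimpleGraph V} (hT : T.IsTree) {S : Set V} {p x : V}
    (hg : Gate T S p) (hx : x ∉ S) : (move T S p x).Connected := by
  have := hT.connected.nonempty
  refine ⟨fun u v => ?_⟩
  by_cases hu : u ∈ S <;> by_cases hv : v ∈ S
  · exact (move_same hT hg hx (by simp [hu, hv])).choose.reachable
  · exact (move_cross hT hg hx hu hv).choose.reachable
  · exact (move_cross hT hg hx hv hu).choose.reachable.symm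
  · exact (move_same hT hg hx (by simp [hu, hv])).choose.reachable

open Classical in
lemma move_isTree [Fintype V] {T : SimpleGraph V} (hT : T.IsTree) {S : Set V} {p x : V}
    (hg : Gate T S p) (hx : x ∉ S) : (move T S p x).IsTree := by
  have hc := move_connected hT hg hx
  rw [isTree_iff_connected_and_card]
  refine ⟨hc, ?_⟩
  have h1 := hc.card_vert_le_card_edgeSet_add_one
  have h2 := (isTree_iff_connected_and_card.1 hT).2
  let f : Sym2 V → Sym2 V := fun e =>
    if ∃ s ∈ S, s ∈ e then e.map (fun v => if v = p then x else v) else e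
  have hsub : (move T S p x).edgeSet ⊆ f '' T.edgeSet := by
    have base : ∀ u v, ((T.Adj u v ∧ (u ∈ S ↔ v ∈ S)) ∨ (u ∈ S ∧ v = x ∧ T.Adj u p)) →
        s(u, v) ∈ f '' T.edgeSet := by
      rintro u v (⟨hadj, hS⟩ | ⟨hu, rfl, hadj⟩)
      · refine ⟨s(u, v), hadj, ?_⟩
        by_cases hu : u ∈ S
        · have hv := hS.1 hu
          have hup : u ≠ p := fun h => hg.1 (h ▸ hu)
          have hvp : v ≠ p := fun h => hg.1 (h ▸ hv)
          simp only [f]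
          rw [if_pos ⟨u, hu, by simp⟩]
          simp [hup, hvp]
        · have hv : v ∉ S := fun h => hu (hS.2 h)
          simp only [f]
          rw [if_neg]
          rintro ⟨s, hs, hse⟩
          rcases Sym2.mem_iff.1 hse with rfl | rfl
          · exact hu hs
          · exact hv hs
      · refine ⟨s(u, p), hadj, ?_⟩
        have hup : u ≠ p := fun h => hg.1 (h ▸ hu)
        simp only [f]
        rw [if_pos ⟨u, hu, by simp⟩]
        simp [hup]
    intro e he
    induction e with
    | _ u v =>
      rw [mem_edgeSet, move, fromRel_adj] at he
      rcases he.2 with h | h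
      · exact base u v h
      · rw [Sym2.eq_swap]; exact base v u h
  have h3 : (move T S p x).edgeSet.ncard ≤ T.edgeSet.ncard :=
    (Set.ncard_le_ncard hsub (Set.toFinite _)).trans (Set.ncard_image_le (Set.toFinite _))
  simp only [← Nat.card_coe_set_eq] at h3
  omega

/-- double sum of distances -/
noncomputable def tot [Fintype V] (T : SimpleGraph V) : ℕ := ∑ u, ∑ v, T.dist u v

open Classical in
lemma tot_move [Fintype V] {T : SimpleGraph V} (hT : T.IsTree) {S : Set V} {p x : V}
    (hg : Gate T S p) (hx : x ∉ S) :
    (tot (move T S p x) : ℤ) ≤ tot T +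
      2 * (S.ncard * ((D T x : ℤ) - D T p - S.ncard * T.dist p x)) := by
  -- weight of the shift
  let g : V → ℤ := fun y => if y ∈ S then 0 else (T.dist x y : ℤ) - T.dist p y
  let i : V → ℤ := fun y => if y ∈ S then 1 else 0
  have hi : ∑ y, i y = S.ncard := by
    simp only [i]
    rw [Finset.sum_boole, Set.ncard_eq_toFinset_card', ← Set.filter_mem_univ_eq_toFinset]
  have hgs : ∑ y, g y = (D T x : ℤ) - D T p - S.ncard * T.dist p x := by
    have : ∀ y, g y = (T.dist x y : ℤ) - T.dist p y - i y * T.dist p x := by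
      intro y
      simp only [g, i]
      split_ifs with hy
      · have h1 := hg.2 y hy x hx
        simp only [T.dist_comm (u := y)] at h1
        push_cast [h1]
        ring
      · ring
    simp only [this, Finset.sum_sub_distrib, ← Finset.sum_mul, hi, D]
    push_cast
    ring
  have hpt : ∀ u v, ((move T S p x).dist u v : ℤ) ≤ T.dist u v + (i u * g v + g u * i v) := by
    intro u v
    by_cases hu : u ∈ S <;> by_cases hv : v ∈ S
    · obtain ⟨w, hw⟩ := move_same (u := u) (v := v) hT hg hx (by simp [hu, hv])
      have := dist_le w
      simp [i, g, hu, hv]; omega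
    · obtain ⟨w, hw⟩ := move_cross hT hg hx hu hv
      have := dist_le w
      have h2 := hg.2 u hu v hv
      simp [i, g, hu, hv]; omega
    · obtain ⟨w, hw⟩ := move_cross hT hg hx hv hu
      have := dist_le w
      have h2 := hg.2 v hv u hu
      rw [SimpleGraph.dist_comm] at this h2
      simp [i, g, hu, hv]; omega
    · obtain ⟨w, hw⟩ := move_same (u := u) (v := v) hT hg hx (by simp [hu, hv])
      have := dist_le w
      simp [i, g, hu, hv]; omega
  have : (tot (move T S p x) : ℤ) ≤ ∑ u, ∑ v, ((T.dist u v : ℤ) + (i u * g v + g u * i v)) := by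
    unfold tot
    push_cast
    exact Finset.sum_le_sum fun u _ => Finset.sum_le_sum fun v _ => hpt u v
  refine this.trans (le_of_eq ?_)
  simp only [Finset.sum_add_distrib, ← Finset.mul_sum, ← Finset.sum_mul, hi, hgs, tot]
  push_cast
  ring

lemma mad_ineq [Fintype V] {G T : SimpleGraph V} (hM : IsMADTree G T) {S : Set V} {p x : V}
    (hg : Gate T S p) (hx : x ∉ S) (hS : S.Nonempty)
    (hadj : ∀ s ∈ S, T.Adj s p → G.Adj s x) :
    D T p + S.ncard * T.dist p x ≤ D T x := by
  have hT := hM.1.2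
  have hle : move T S p x ≤ G := by
    intro u v h
    rw [move, fromRel_adj] at h
    obtain ⟨-, (h | ⟨hu, rfl, h⟩) | (h | ⟨hu, rfl, h⟩)⟩ := h
    · exact hM.1.1 h.1
    · exact hadj u hu h
    · exact (hM.1.1 h.1).symm
    · exact (hadj v hu h).symm
  have h1 := hM.2 _ ⟨hle, move_isTree hT hg hx⟩
  have h2 := tot_move hT hg hx
  by_contra hcon
  push Not at hcon
  have h3 : (D T x : ℤ) - D T p - S.ncard * T.dist p x ≤ -1 := by
    zify at hcon
    linarith
  have h4 : 0 < S.ncard := (Set.ncard_pos (Set.toFinite _)).2 hS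
  have h5 : (S.ncard : ℤ) * ((D T x : ℤ) - D T p - S.ncard * T.dist p x) ≤ -1 := by
    have : (1 : ℤ) ≤ S.ncard := by exact_mod_cast h4
    nlinarith
  change tot T / 2 ≤ tot (move T S p x) / 2 at h1
  omega

end MadAux

namespace MadAux

set_option linter.unusedSectionVars false

variable {V : Type*}

lemma hom_dist_le {W : Type*} {A : SimpleGraph V} {B : SimpleGraph W} (hA : A.Connected)
    (f : A →g B) (u v : V) : B.dist (f u) (f v) ≤ A.dist u v := by
  obtain ⟨w, hw⟩ := hA.exists_walk_length_eq_dist u v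
  rw [← hw, ← Walk.length_map f w]
  exact dist_le _

lemma comap_isTree {T : SimpleGraph V} (hT : T.IsTree) (σ : V ≃ V) : (T.comap σ).IsTree :=
  (SimpleGraph.Iso.comap σ T).isTree_iff.2 hT

lemma comap_dist {T : SimpleGraph V} (hT : T.IsTree) (σ : V ≃ V) (u v : V) :
    (T.comap σ).dist u v = T.dist (σ u) (σ v) := by
  apply le_antisymm
  · have := hom_dist_le hT.connected (SimpleGraph.Iso.comap σ T).symm.toHom (σ u) (σ v)
    simpa using this
  · exact hom_dist_le (comap_isTree hT σ).connected (SimpleGraph.Iso.comap σ T).toHom u v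

variable [Fintype V]

lemma comap_D {T : SimpleGraph V} (hT : T.IsTree) (σ : V ≃ V) (u : V) :
    D (T.comap σ) u = D T (σ u) := by
  unfold D
  simp only [comap_dist hT]
  exact Equiv.sum_comp σ (fun y => T.dist (σ u) y)

lemma comap_wiener {T : SimpleGraph V} (hT : T.IsTree) (σ : V ≃ V) :
    wiener (T.comap σ) = wiener T := by
  have h : ∀ S : SimpleGraph V, wiener S = (∑ u, D S u) / 2 := fun S => rfl
  rw [h, h]
  simp only [comap_D hT]
  rw [Equiv.sum_comp σ (fun y => D T y)]

/-- `T` is a MAD tree and `r` is a median vertex of `T`. -/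
def Good (G T : SimpleGraph V) (r : V) : Prop := IsMADTree G T ∧ ∀ x, D T r ≤ D T x

lemma comap_good {G T : SimpleGraph V} {r r' : V} (h : Good G T r) (σ : V ≃ V)
    (hr : σ r' = r) (hle : T.comap σ ≤ G) : Good G (T.comap σ) r' := by
  have hT := h.1.1.2
  refine ⟨⟨⟨hle, comap_isTree hT σ⟩, fun T' hT' => ?_⟩, fun x => ?_⟩
  · rw [comap_wiener hT]; exact h.1.2 T' hT'
  · rw [comap_D hT, comap_D hT, hr]; exact h.2 _

lemma exists_good (G : SimpleGraph V) (hG : G.Connected) : ∃ T r, Good G T r := by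
  classical
  obtain ⟨T0, hle, hT0⟩ := hG.exists_isTree_le
  obtain ⟨T, hT, hmin⟩ := Finset.exists_min_image
    (Finset.univ.filter fun T : SimpleGraph V => IsSpanningTree G T) wiener
    ⟨T0, Finset.mem_filter.2 ⟨Finset.mem_univ _, hle, hT0⟩⟩
  simp only [Finset.mem_filter, Finset.mem_univ, true_and] at hT hmin
  have := hG.nonempty
  obtain ⟨r, -, hr⟩ := Finset.exists_min_image (Finset.univ : Finset V) (D T)
    Finset.univ_nonempty
  exact ⟨T, r, ⟨hT, hmin⟩, fun x => hr x (Finset.mem_univ x)⟩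

/-- `x` lies on the tree path from `r` to `y`. -/
def Anc (T : SimpleGraph V) (r x y : V) : Prop := T.dist r y = T.dist r x + T.dist x y

lemma good_anc {G T : SimpleGraph V} {r : V} (h : Good G T r) {x y : V} (ha : Anc T r x y)
    (hG : G.Adj x y) : T.Adj x y := by
  have hT := h.1.1.2
  by_contra hcon
  have hne : y ≠ x := hG.ne'
  obtain ⟨p, hp, hd⟩ := exists_parent hT hne
  have hpx : p ≠ x := by rintro rfl; exact hcon hp.symm
  have hgate := gate_half hT hp.symm
  unfold Anc at ha
  have hx : x ∉ half T p y := by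
    simp only [half, Set.mem_ofPred_eq]
    simp only [T.dist_comm (u := x)] at *
    omega
  have hpos := hT.connected.pos_dist_of_ne hpx
  have hy : y ∈ half T p y := by
    simp only [half, Set.mem_ofPred_eq]
    rw [dist_eq_one_iff_adj.2 hp.symm]; simp
  have hineq := mad_ineq h.1 hgate hx ⟨y, hy⟩ (by
    intro s hs hsp
    have : s = y := by
      simp only [half, Set.mem_ofPred_eq] at hs
      rw [dist_eq_one_iff_adj.2 hsp.symm] at hs
      exact ((hT.connected.dist_eq_zero_iff).1 (by omega : T.dist y s = 0)).symm
    rw [this]; exact hG.symm)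
  have h1 := adj_cases hT r hp
  have h2 := hT.connected.dist_triangle (u := r) (v := x) (w := p)
  have h3 := D_mono hT h.2 x _ p rfl (by omega)
  have h4 : 0 < (half T p y).ncard := (Set.ncard_pos (Set.toFinite _)).2 ⟨y, hy⟩
  have := Nat.mul_pos h4 hpos
  omega

lemma good_root {G T : SimpleGraph V} {r : V} (h : Good G T r) : IsRoot G T r := by
  classical
  have hT := h.1.1.2
  have key : ∀ (y : V) (p : T.Walk r y), p.IsPath → ∀ x ∈ p.support, G.Adj x y →
      s(x, y) ∈ p.edges := by
    intro y p hp x hx hxy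
    have hadj := good_anc h (geod_split hT p (path_len hT p hp) hx) hxy
    have h1 := (hT.isAcyclic.subsingleton_path x y).elim
      ⟨p.dropUntil x hx, hp.dropUntil hx⟩ (Path.singleton hadj)
    have h2 : (p.dropUntil x hx).edges = [s(x, y)] := by
      have h3 : p.dropUntil x hx = _ := congrArg Subtype.val h1
      rw [h3]; simp [Path.singleton]
    apply p.edges_dropUntil_subset_edges hx
    rw [h2]; simp
  intro v p hp x hx y hy hxy
  have hsp := Walk.take_spec p hy
  have hx' : x ∈ ((p.takeUntil y hy).append (p.dropUntil y hy)).support := by rwa [hsp]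
  rw [Walk.mem_support_append_iff] at hx'
  rcases hx' with hx' | hx'
  · exact p.edges_takeUntil_subset_edges hy (key y _ (hp.takeUntil hy) x hx' hxy)
  · have hy' : y ∈ (p.takeUntil x hx).support := by
      by_contra hcon
      have h1 := path_len hT _ (hp.takeUntil hx)
      have h2 := path_len hT _ (hp.takeUntil hy)
      have h3 := path_len hT _ ((hp.dropUntil hy).takeUntil hx')
      have happ : ((p.takeUntil y hy).append ((p.dropUntil y hy).takeUntil x hx')).IsPath := by
        apply Walk.IsPath.of_append_left (q := (p.dropUntil y hy).dropUntil x hx')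
        rw [← Walk.append_assoc, Walk.take_spec, Walk.take_spec]
        exact hp
      have h4 := (hT.isAcyclic.subsingleton_path r x).elim
        ⟨p.takeUntil x hx, hp.takeUntil hx⟩ ⟨_, happ⟩
      apply hcon
      have h5 : p.takeUntil x hx = _ := congrArg Subtype.val h4
      rw [h5, Walk.mem_support_append_iff]
      left; simp
    have := key x _ (hp.takeUntil hx) y hy' hxy.symm
    rw [Sym2.eq_swap]
    exact p.edges_takeUntil_subset_edges hx this

/-- A vertex with two neighbours that is not `r` has a parent and a child. -/
lemma exists_child {T : SimpleGraph V} (hT : T.IsTree) {r u : V} (hu : u ≠ r)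
    (h : 2 ≤ (T.neighborSet u).ncard) : ∃ c, T.Adj u c ∧ T.dist r c = T.dist r u + 1 := by
  obtain ⟨e, he, hd⟩ := exists_parent hT hu
  obtain ⟨a, ha, b, hb, hab⟩ := (Set.one_lt_ncard (Set.toFinite _)).1 h
  by_cases hae : a = e
  · subst hae
    exact ⟨b, hb, other_far hT he hb hab hd⟩
  · exact ⟨a, ha, other_far hT he ha (Ne.symm hae) hd⟩

lemma mod_adj {G : SimpleGraph V} {M : Set V} (hM : IsModule G M) {x u v : V} (hx : x ∉ M)
    (hu : u ∈ M) (hv : v ∈ M) (h : G.Adj x u) : G.Adj x v := by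
  rcases hM x hx with h1 | h1
  · exact h1 v hv
  · exact absurd h (h1 u hu)

lemma anc_trans {T : SimpleGraph V} (hT : T.IsTree) {r x y z : V} (h1 : Anc T r x y)
    (h2 : Anc T r y z) : Anc T r x z := by
  unfold Anc at *
  have h3 := hT.connected.dist_triangle (u := x) (v := y) (w := z)
  have h4 := hT.connected.dist_triangle (u := r) (v := x) (w := z)
  omega

lemma anc_adj {T : SimpleGraph V} {r x y : V} (h : T.Adj x y)
    (hd : T.dist r y = T.dist r x + 1) : Anc T r x y := by
  unfold Anc; rw [dist_eq_one_iff_adj.2 h, hd]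

lemma anc_self {T : SimpleGraph V} {r x : V} : Anc T r x x := by simp [Anc]

/-- entry point of the tree path into a module not containing the root -/
lemma entry {G T : SimpleGraph V} {r : V} (h : Good G T r) {M : Set V} (hr : r ∉ M) :
    ∀ (n : ℕ) (u : V), u ∈ M → T.dist r u = n →
      ∃ q w, q ∉ M ∧ w ∈ M ∧ T.Adj q w ∧ T.dist r w = T.dist r q + 1 ∧ Anc T r w u := by
  have hT := h.1.1.2
  intro n
  induction n with
  | zero =>
    intro u hu hd
    have : r = u := (hT.connected.dist_eq_zero_iff).1 hd
    exact absurd (this ▸ hu) hr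
  | succ n ih =>
    intro u hu hd
    have hur : u ≠ r := fun h => hr (h ▸ hu)
    obtain ⟨e, he, hde⟩ := exists_parent hT hur
    by_cases heM : e ∈ M
    · obtain ⟨q, w, hq, hw, hqw, h1, h2⟩ := ih e heM (by omega)
      exact ⟨q, w, hq, hw, hqw, h1, anc_trans hT h2 (anc_adj he.symm hde)⟩
    · exact ⟨e, u, heM, hu, he.symm, hde, anc_self⟩

lemma anc_eq {G T : SimpleGraph V} {r : V} (h : Good G T r) {M : Set V} (hM : IsModule G M)
    (hr : r ∉ M) {u v : V} (hu : u ∈ M) (hv : v ∈ M) (ha : Anc T r u v) : u = v := by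
  have hT := h.1.1.2
  obtain ⟨q, w, hq, hw, hqw, h1, h2⟩ := entry h hr _ u hu rfl
  have hqv : Anc T r q v := anc_trans hT (anc_adj hqw h1) (anc_trans hT h2 ha)
  have hadj := good_anc h hqv (mod_adj hM hq hw hv (h.1.1.1 hqw))
  have h3 : T.dist q v = 1 := dist_eq_one_iff_adj.2 hadj
  unfold Anc at *
  exact (hT.connected.dist_eq_zero_iff).1 (by omega)

lemma half_anc {T : SimpleGraph V} (hT : T.IsTree) {r e u z : V} (he : T.Adj e u)
    (hd : T.dist r u = T.dist r e + 1) (hz : z ∈ half T e u) : Anc T r u z := by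
  simp only [half, Set.mem_ofPred_eq] at hz
  have := cross hT he (z := z) (w := r) hz (by simp only [T.dist_comm (v := r)]; exact hd)
  unfold Anc
  simp only [T.dist_comm (v := r)] at *
  rw [T.dist_comm (u := z)] at this
  omega

lemma child_half {T : SimpleGraph V} (hT : T.IsTree) {r e u c : V} (he : T.Adj e u)
    (hd : T.dist r u = T.dist r e + 1) (hc : T.Adj u c) (hdc : T.dist r c = T.dist r u + 1) :
    c ∈ half T e u \ {u} := by
  refine ⟨?_, fun h => hc.ne h.symm⟩
  simp only [half, Set.mem_ofPred_eq]
  have h1 := other_far hT (z := e) (a := u) (e := e) (b := c) he.symm hc (by rintro rfl; omega)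
    (by rw [dist_eq_one_iff_adj.2 he]; simp)
  rw [h1, dist_eq_one_iff_adj.2 hc, dist_eq_one_iff_adj.2 he]

/-- neighbours of `u` in the lower half are children -/
lemma half_child {T : SimpleGraph V} (hT : T.IsTree) {r e u c : V} (he : T.Adj e u)
    (hd : T.dist r u = T.dist r e + 1) (hc : c ∈ half T e u \ {u}) (hcu : T.Adj c u) :
    T.dist r c = T.dist r u + 1 := by
  have := half_anc hT he hd hc.1
  unfold Anc at this
  rw [this, dist_eq_one_iff_adj.2 hcu.symm]

lemma poly_ineq {G T : SimpleGraph V} {r : V} (h : Good G T r) {M : Set V} (hM : IsModule G M)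
    (hr : r ∉ M) {u v : V} (hu : u ∈ M) (hv : v ∈ M) (hne : u ≠ v)
    (h2 : 2 ≤ (T.neighborSet u).ncard) : D T u < D T v := by
  have hT := h.1.1.2
  have hur : u ≠ r := fun h => hr (h ▸ hu)
  obtain ⟨e, he, hde⟩ := exists_parent hT hur
  obtain ⟨c, hc, hdc⟩ := exists_child hT hur h2
  have hcS := child_half hT he.symm hde hc hdc
  have hvS : v ∉ half T e u \ {u} := fun hvS =>
    hne (anc_eq h hM hr hu hv (half_anc hT he.symm hde hvS.1))
  have hi := mad_ineq h.1 (gate_half' hT he.symm) hvS ⟨c, hcS⟩ (by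
    intro s hs hsu
    have hsM : s ∉ M := fun hsM =>
      hs.2 (anc_eq h hM hr hu hsM (half_anc hT he.symm hde hs.1)).symm
    exact mod_adj hM hsM hu hv (h.1.1.1 hsu))
  have h4 : 0 < (half T e u \ {u}).ncard := (Set.ncard_pos (Set.toFinite _)).2 ⟨c, hcS⟩
  have := Nat.mul_pos h4 (hT.connected.pos_dist_of_ne hne)
  omega

lemma poly_other {G T : SimpleGraph V} {r : V} (h : Good G T r) {M : Set V}
    (hM : IsModule G M) (hr : r ∉ M) {u v : V} (hu : u ∈ M) (hv : v ∈ M)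
    (h2 : 2 ≤ (T.neighborSet u).ncard) (h3 : 2 ≤ (T.neighborSet v).ncard) : u = v := by
  by_contra hne
  have h4 := poly_ineq h hM hr hu hv hne h2
  have h5 := poly_ineq h hM hr hv hu (Ne.symm hne) h3
  omega

end MadAux

namespace MadAux

variable {V : Type*} [Fintype V]

lemma child_in {G T : SimpleGraph V} {r : V} (h : Good G T r) {M : Set V} (hM : IsModule G M)
    (hr : r ∈ M) {u c : V} (hu : u ∈ M) (hur : u ≠ r) (hc : T.Adj u c)
    (hd : T.dist r c = T.dist r u + 1) : c ∈ M := by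
  have hT := h.1.1.2
  by_contra hcM
  have h1 : G.Adj c r := mod_adj hM hcM hu hr (h.1.1.1 hc.symm)
  have h2 := good_anc h (x := r) (y := c) (by simp [Anc]) h1.symm
  have h3 := dist_eq_one_iff_adj.2 h2
  have h4 := hT.connected.pos_dist_of_ne hur.symm
  omega

lemma exists_out {G T : SimpleGraph V} {r : V} (h : Good G T r) {M : Set V}
    (hM : IsModule G M) (hr : r ∈ M) : ∀ (n : ℕ) (z : V), z ∉ M → T.dist r z = n →
      ∃ q, q ∉ M ∧ T.Adj r q := by
  have hT := h.1.1.2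
  intro n
  induction n with
  | zero =>
    intro z hz hd
    exact absurd ((hT.connected.dist_eq_zero_iff).1 hd ▸ hr) hz
  | succ n ih =>
    intro z hz hd
    have hzr : z ≠ r := fun h => hz (h ▸ hr)
    obtain ⟨e, he, hde⟩ := exists_parent hT hzr
    by_cases heM : e ∈ M
    · refine ⟨z, hz, good_anc h (by simp [Anc]) ?_⟩
      exact (mod_adj hM hz heM hr (h.1.1.1 he)).symm
    · exact ih e heM (by omega)

open Classical in
lemma D_adj {T : SimpleGraph V} (hT : T.IsTree) {a b : V} (h : T.Adj a b) :
    D T b + 2 * (half T a b).ncard = D T a + Fintype.card V := by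
  have hi : (half T a b).ncard = ∑ z : V, if z ∈ half T a b then 1 else 0 := by
    rw [Finset.sum_boole, Set.ncard_eq_toFinset_card', ← Set.filter_mem_univ_eq_toFinset]
    simp
  have hn : Fintype.card V = ∑ z : V, 1 := by simp
  rw [hi, hn]
  unfold D
  rw [Finset.mul_sum, ← Finset.sum_add_distrib, ← Finset.sum_add_distrib]
  apply Finset.sum_congr rfl
  intro z _
  have h1 := adj_cases hT z h
  simp only [T.dist_comm (u := z)] at h1
  by_cases hz : z ∈ half T a b
  · rw [if_pos hz]
    simp only [half, Set.mem_ofPred_eq] at hz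
    omega
  · rw [if_neg hz]
    simp only [half, Set.mem_ofPred_eq] at hz
    omega

lemma leaf_q {G T : SimpleGraph V} {r : V} (h : Good G T r) {M : Set V} (hM : IsModule G M)
    (hr : r ∈ M) {q a b : V} (hq : q ∉ M) (hrq : T.Adj r q) (ha : a ∈ M) (hra : T.Adj r a)
    (hab : T.Adj a b) (hbr : b ≠ r) : ∀ c, T.Adj q c → c = r := by
  have hT := h.1.1.2
  have hda : T.dist r a = T.dist r r + 1 := by rw [dist_eq_one_iff_adj.2 hra]; simp
  have hdq : T.dist r q = T.dist r r + 1 := by rw [dist_eq_one_iff_adj.2 hrq]; simp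
  have hdb : T.dist r b = T.dist r a + 1 :=
    other_far hT hra.symm hab (Ne.symm hbr) hda
  have hbS := child_half hT hra hda hab hdb
  have haq : a ≠ q := fun h => hq (h ▸ ha)
  have hd2 : 2 ≤ T.dist a q := by
    have h1 := hT.connected.pos_dist_of_ne haq
    by_contra hcon
    have h2 : T.Adj a q := dist_eq_one_iff_adj.1 (by omega)
    have := adj_cases hT r h2
    omega
  have hqS : q ∉ half T r a \ {a} := by
    intro hqS
    have := half_anc hT hra hda hqS.1
    unfold Anc at this
    omega
  have hi := mad_ineq h.1 (gate_half' hT hra) hqS ⟨b, hbS⟩ (by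
    intro s hs hsa
    have hsM := child_in h hM hr ha hra.ne' hsa.symm (half_child hT hra hda hs hsa)
    exact (mod_adj hM hq hr hsM (h.1.1.1 hrq.symm)).symm)
  have hca := D_adj hT hra
  have hcq := D_adj hT hrq
  have haH : a ∈ half T r a := by
    simp only [half, Set.mem_ofPred_eq]
    rw [dist_eq_one_iff_adj.2 hra]; simp
  have hqH : q ∈ half T r q := by
    simp only [half, Set.mem_ofPred_eq]
    rw [dist_eq_one_iff_adj.2 hrq]; simp
  have hcard := Set.ncard_sdiff_singleton_add_one haH (Set.toFinite _)
  have hmul : (half T r a \ {a}).ncard * 2 ≤ (half T r a \ {a}).ncard * T.dist a q :=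
    Nat.mul_le_mul_left _ hd2
  have hle : (half T r q).ncard ≤ 1 := by omega
  intro c hc
  by_contra hcr
  have hdc : T.dist r c = T.dist r q + 1 := other_far hT hrq.symm hc (Ne.symm hcr) hdq
  have hcH := child_half hT hrq hdq hc hdc
  exact hcH.2 ((Set.ncard_le_one (Set.toFinite _)).1 hle c hcH.1 q hqH)

/-- number of tree edges inside the module -/
noncomputable def phi (T : SimpleGraph V) (M : Set V) : ℕ :=
  {e : V × V | e.1 ∈ M ∧ e.2 ∈ M ∧ T.Adj e.1 e.2}.ncard

open Classical in
lemma step {G T : SimpleGraph V} {r : V} (h : Good G T r) {M : Set V} (hM : IsModule G M)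
    (hr : r ∈ M) {q a b : V} (hq : q ∉ M) (hrq : T.Adj r q) (ha : a ∈ M) (hra : T.Adj r a)
    (hab : T.Adj a b) (hbr : b ≠ r) : ∃ T', Good G T' r ∧ phi T' M < phi T M := by
  have hT := h.1.1.2
  have hleaf := leaf_q h hM hr hq hrq ha hra hab hbr
  have hda : T.dist r a = T.dist r r + 1 := by rw [dist_eq_one_iff_adj.2 hra]; simp
  have haq : a ≠ q := fun h => hq (h ▸ ha)
  have hin : ∀ c, T.Adj a c → c ∈ M := by
    intro c hc
    by_cases hcr : c = r
    · rw [hcr]; exact hr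
    · exact child_in h hM hr ha hra.ne' hc (other_far hT hra.symm hc (Ne.symm hcr) hda)
  let σ : V ≃ V := Equiv.swap a q
  have hσa : σ a = q := Equiv.swap_apply_left a q
  have hσq : σ q = a := Equiv.swap_apply_right a q
  have hσ : ∀ x, x ≠ a → x ≠ q → σ x = x := fun x h1 h2 => Equiv.swap_apply_of_ne_of_ne h1 h2
  have hrq' : r ≠ q := hrq.ne
  have hra' : r ≠ a := hra.ne
  have hσr : σ r = r := hσ r hra' hrq'
  have hGq : ∀ m ∈ M, G.Adj q m := fun m hm => mod_adj hM hq hr hm (h.1.1.1 hrq.symm)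
  have key : ∀ u v, u = a ∨ u = q → T.Adj (σ u) (σ v) → G.Adj u v := by
    rintro u v (rfl | rfl) huv
    · rw [hσa] at huv
      have h1 : σ v = σ r := by rw [hσr]; exact hleaf _ huv
      rw [σ.injective h1]
      exact h.1.1.1 hra.symm
    · rw [hσq] at huv
      have h1 := hin _ huv
      apply hGq
      by_cases hva : v = a
      · rw [hva]; exact ha
      by_cases hvq : v = u
      · rw [hvq, hσq] at huv
        exact absurd rfl huv.ne
      · rwa [hσ v hva hvq] at h1
  have hle : T.comap σ ≤ G := by
    intro u v huv
    rw [comap_adj] at huv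
    by_cases hu : u = a ∨ u = q
    · exact key u v hu huv
    by_cases hv : v = a ∨ v = q
    · exact (key v u hv huv.symm).symm
    push Not at hu hv
    rw [hσ u hu.1 hu.2, hσ v hv.1 hv.2] at huv
    exact h.1.1.1 huv
  refine ⟨T.comap σ, comap_good h σ hσr hle, ?_⟩
  unfold phi
  apply Set.ncard_lt_ncard _ (Set.toFinite _)
  have hkey2 : ∀ v, T.Adj q (σ v) → v = r := by
    intro v hv
    have h1 : σ v = σ r := by rw [hσr]; exact hleaf _ hv
    exact σ.injective h1
  refine ⟨?_, ?_⟩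
  · rintro ⟨u, v⟩ ⟨hu, hv, huv⟩
    refine ⟨hu, hv, ?_⟩
    simp only [comap_adj] at hu hv huv ⊢
    have huq : u ≠ q := fun h => hq (h ▸ hu)
    have hvq : v ≠ q := fun h => hq (h ▸ hv)
    by_cases hua : u = a
    · rw [hua, hσa] at huv
      rw [hua, hkey2 v huv]
      exact hra.symm
    by_cases hva : v = a
    · rw [hva, hσa] at huv
      rw [hva, hkey2 u huv.symm]
      exact hra
    rwa [hσ u hua huq, hσ v hva hvq] at huv
  · intro hsub
    have h1 : (a, b) ∈ {e : V × V | e.1 ∈ M ∧ e.2 ∈ M ∧ (T.comap σ).Adj e.1 e.2} :=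
      hsub ⟨ha, hin b hab, hab⟩
    have h2 := h1.2.2
    simp only [comap_adj] at h2
    rw [hσa] at h2
    exact hbr (hkey2 b h2)

lemma exists_min {G : SimpleGraph V} {r : V} {M : Set V} (hM : IsModule G M)
    (hr : r ∈ M) {z : V} (hz : z ∉ M) : ∀ (n : ℕ) (T : SimpleGraph V), phi T M = n →
      Good G T r → ∃ T', Good G T' r ∧ ∀ a ∈ M, T'.Adj r a → ∀ b, T'.Adj a b → b = r := by
  intro n
  induction n using Nat.strong_induction_on with
  | _ n ih =>
    intro T hn h
    by_cases hgood : ∀ a ∈ M, T.Adj r a → ∀ b, T.Adj a b → b = r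
    · exact ⟨T, h, hgood⟩
    · push Not at hgood
      obtain ⟨a, ha, hra, b, hab, hbr⟩ := hgood
      obtain ⟨q, hq, hrq⟩ := exists_out h hM hr _ z hz rfl
      obtain ⟨T', h', hlt⟩ := step h hM hr hq hrq ha hra hab hbr
      exact ih _ (hn ▸ hlt) T' rfl h'

lemma no_child {G T : SimpleGraph V} {r : V} (h : Good G T r) {M : Set V} (hM : IsModule G M)
    (hr : r ∈ M) (hmin : ∀ a ∈ M, T.Adj r a → ∀ b, T.Adj a b → b = r) :
    ∀ (n : ℕ) (u c : V), T.dist r u = n → u ∈ M → u ≠ r → T.Adj u c →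
      T.dist r c = T.dist r u + 1 → False := by
  have hT := h.1.1.2
  intro n
  induction n with
  | zero =>
    intro u c hd _ hur _ _
    exact hur ((hT.connected.dist_eq_zero_iff).1 hd).symm
  | succ n ih =>
    intro u c hd hu hur hc hdc
    have hcM := child_in h hM hr hu hur hc hdc
    obtain ⟨e, he, hde⟩ := exists_parent hT hur
    by_cases her : e = r
    · subst her
      have := hmin u hu he.symm c hc
      subst this
      simp at hdc
    · by_cases heM : e ∈ M
      · exact ih e u (by omega) heM her he.symm hde
      · have h1 := mod_adj hM heM hu hcM (h.1.1.1 he.symm)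
        have h2 := good_anc h (anc_trans hT (anc_adj he.symm hde) (anc_adj hc hdc)) h1
        have := adj_cases hT r h2
        omega

lemma exists_perm {M : Set V} {A B : Set V} {r r' : V} (hr : r ∈ M) (hr' : r' ∈ M)
    (hA : A ⊆ M) (hB : B ⊆ M) (hrA : r ∉ A) (hrB : r' ∉ B) (hle : A.ncard ≤ B.ncard) :
    ∃ σ : V ≃ V, σ r = r' ∧ (∀ x ∉ M, σ x = x) ∧ ∀ x ∈ A, σ x ∈ B := by
  classical
  have hne : Nonempty V := ⟨r⟩
  obtain ⟨f, hf, hinj⟩ := Set.Finite.exists_injOn_of_encard_le (s := A) (t := B)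
    (Set.toFinite _) (by
      rw [← Set.Finite.cast_ncard_eq (Set.toFinite A), ← Set.Finite.cast_ncard_eq (Set.toFinite B)]
      exact_mod_cast hle)
  let g : V → V := fun x => if x = r then r' else if x ∈ A then f x else x
  have gr : g r = r' := by simp [g]
  have gA : ∀ x ∈ A, g x = f x := by
    intro x hx
    have : x ≠ r := fun h => hrA (h ▸ hx)
    simp [g, this, hx]
  have gM : ∀ x ∉ M, g x = x := by
    intro x hx
    have h1 : x ≠ r := fun h => hx (h ▸ hr)
    have h2 : x ∉ A := fun h => hx (hA h)
    simp [g, h1, h2]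
  have hg : Set.InjOn g ({r} ∪ A ∪ Mᶜ) := by
    rintro x ((rfl | hx) | hx) y ((rfl | hy) | hy) hxy
    · rfl
    · rw [gr, gA y hy] at hxy
      exact absurd (hxy ▸ hf hy : r' ∈ B) hrB
    · rw [gr, gM y hy] at hxy
      exact absurd (hxy ▸ hr') hy
    · rw [gr, gA x hx] at hxy
      exact absurd (hxy ▸ hf hx : r' ∈ B) hrB
    · rw [gA x hx, gA y hy] at hxy
      exact hinj hx hy hxy
    · rw [gA x hx, gM y hy] at hxy
      exact absurd (hB (hxy ▸ hf hx : y ∈ B)) hy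
    · rw [gr, gM x hx] at hxy
      exact absurd (hxy ▸ hr') hx
    · rw [gM x hx, gA y hy] at hxy
      exact absurd (hB (hxy ▸ hf hy : x ∈ B)) hx
    · rw [gM x hx, gM y hy] at hxy
      exact hxy
  obtain ⟨e, he⟩ := Set.MapsTo.exists_equiv_extend_of_card_eq (t := (Finset.univ : Finset V))
    (by simp) (s := {r} ∪ A ∪ Mᶜ) (f := g) (by intro x _; simp) hg
  let τ : V ≃ V := e.trans (Equiv.subtypeUnivEquiv (by simp))
  have hτ : ∀ x ∈ ({r} ∪ A ∪ Mᶜ : Set V), τ x = g x := fun x hx => he x hx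
  refine ⟨τ, ?_, ?_, ?_⟩
  · rw [hτ r (by simp), gr]
  · intro x hx
    rw [hτ x (Or.inr hx), gM x hx]
  · intro x hx
    rw [hτ x (Or.inl (Or.inr hx)), gA x hx]
    exact hf hx

lemma perm_mem {M : Set V} {σ : V ≃ V} (h : ∀ x ∉ M, σ x = x) (x : V) : σ x ∈ M ↔ x ∈ M := by
  have hinv : ∀ x ∉ M, σ.symm x = x := fun x hx => by
    rw [Equiv.symm_apply_eq]; exact (h x hx).symm
  constructor
  · intro hx
    by_contra hcon
    rw [h x hcon] at hx
    exact hcon hx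
  · intro hx
    by_contra hcon
    have := hinv _ hcon
    rw [Equiv.symm_apply_apply] at this
    rw [← this] at hcon
    exact hcon hx

end MadAux

theorem stmt7 {V : Type*} [Fintype V] (G : SimpleGraph V) (hG : G.Connected)
    {k : ℕ} (M : Fin k → Set V) (hM : IsModularPartition G M) :
    ∃ (T : SimpleGraph V) (i : Fin k) (r : V),
      IsMADTree G T ∧ IsPolyStar T M ∧ r ∈ M i ∧ IsRoot G T r ∧
      ∀ v ∈ M i, (G.neighborSet v).ncard ≤ (G.neighborSet r).ncard := by
  classical
  obtain ⟨hk, hne, hmod, hdisj, hcov⟩ := hM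
  obtain ⟨T0, r, h0⟩ := MadAux.exists_good G hG
  obtain ⟨i, hi⟩ : ∃ i, r ∈ M i := by
    have : r ∈ ⋃ j, M j := by rw [hcov]; trivial
    simpa using this
  obtain ⟨j, hj⟩ : ∃ j : Fin k, j ≠ i := by
    have : Nontrivial (Fin k) := Fin.nontrivial_iff_two_le.2 hk
    exact exists_ne i
  obtain ⟨z, hz⟩ := hne j
  have hzi : z ∉ M i := fun h => Set.disjoint_left.1 (hdisj hj) hz h
  obtain ⟨T, h, hmin⟩ := MadAux.exists_min (hmod i) hi hzi _ T0 rfl h0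
  have hT := h.1.1.2
  have hno := MadAux.no_child h (hmod i) hi hmin
  have hpoly : IsPolyStar T M := by
    intro l u hu v hv h2 h3
    by_cases hrl : r ∈ M l
    · have hli : l = i := by
        by_contra hcon
        exact Set.disjoint_left.1 (hdisj hcon) hrl hi
      subst hli
      have base : ∀ w ∈ M l, 2 ≤ (T.neighborSet w).ncard → w = r := by
        intro w hw hw2
        by_contra hwr
        obtain ⟨c, hc, hdc⟩ := MadAux.exists_child hT hwr hw2
        exact hno _ w c rfl hw hwr hc hdc
      rw [base u hu h2, base v hv h3]
    · exact MadAux.poly_other h (hmod l) hrl hu hv h2 h3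
  obtain ⟨r', hr', hmax⟩ := Set.exists_max_image (M i) (fun v => (G.neighborSet v).ncard)
    (Set.toFinite _) ⟨r, hi⟩
  -- degrees inside the module
  have hcard : (T.neighborSet r ∩ M i).ncard ≤ (G.neighborSet r' ∩ M i).ncard := by
    have h1 : (T.neighborSet r ∩ M i).ncard ≤ (G.neighborSet r ∩ M i).ncard := by
      apply Set.ncard_le_ncard _ (Set.toFinite _)
      rintro x ⟨hx, hxM⟩
      exact ⟨h.1.1.1 hx, hxM⟩
    have h2 : G.neighborSet r \ M i = G.neighborSet r' \ M i := by
      ext x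
      constructor
      · rintro ⟨hx, hxM⟩
        exact ⟨(MadAux.mod_adj (hmod i) hxM hi hr' (SimpleGraph.Adj.symm hx)).symm, hxM⟩
      · rintro ⟨hx, hxM⟩
        exact ⟨(MadAux.mod_adj (hmod i) hxM hr' hi (SimpleGraph.Adj.symm hx)).symm, hxM⟩
    have h3 := Set.ncard_inter_add_ncard_sdiff_eq_ncard (G.neighborSet r) (M i) (Set.toFinite _)
    have h4 := Set.ncard_inter_add_ncard_sdiff_eq_ncard (G.neighborSet r') (M i) (Set.toFinite _)
    have h5 := hmax r hi
    rw [h2] at h3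
    omega
  obtain ⟨σ, hσr, hσM, hσA⟩ := MadAux.exists_perm (M := M i) hi hr'
    (A := T.neighborSet r ∩ M i) (B := G.neighborSet r' ∩ M i)
    Set.inter_subset_right Set.inter_subset_right (by simp) (by simp) hcard
  have hmem := MadAux.perm_mem hσM
  have inside : ∀ x y, x ∈ M i → y ∈ M i → T.Adj x y → T.dist r y = T.dist r x + 1 →
      G.Adj (σ x) (σ y) := by
    intro x y hx hy hxy hd
    have hxr : x = r := by
      by_contra hxr
      exact hno _ x y rfl hx hxr hxy hd
    subst hxr
    rw [hσr]
    exact (hσA y ⟨hxy, hy⟩).1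
  have hadj : ∀ x y, T.Adj x y → G.Adj (σ x) (σ y) := by
    intro x y hxy
    by_cases hx : x ∈ M i <;> by_cases hy : y ∈ M i
    · rcases MadAux.adj_cases hT r hxy with hd | hd
      · exact (inside y x hy hx hxy.symm hd).symm
      · exact inside x y hx hy hxy hd
    · rw [hσM y hy]
      exact (MadAux.mod_adj (hmod i) hy hx ((hmem x).2 hx) (h.1.1.1 hxy.symm)).symm
    · rw [hσM x hx]
      exact MadAux.mod_adj (hmod i) hx hy ((hmem y).2 hy) (h.1.1.1 hxy)
    · rw [hσM x hx, hσM y hy]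
      exact h.1.1.1 hxy
  have hle : T.comap σ.symm ≤ G := by
    intro u v huv
    have := hadj _ _ huv
    simpa using this
  have hgood : MadAux.Good G (T.comap σ.symm) r' :=
    MadAux.comap_good h σ.symm (by rw [← hσr]; simp) hle
  refine ⟨T.comap σ.symm, i, r', hgood.1, ?_, hr', MadAux.good_root hgood, hmax⟩
  have hmemj : ∀ l, ∀ x ∈ M l, σ.symm x ∈ M l := by
    intro l x hx
    by_cases hli : l = i
    · subst hli
      rw [← hmem]; simpa using hx
    · have hxi : x ∉ M i := fun hxi => Set.disjoint_left.1 (hdisj hli) hx hxi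
      have : σ.symm x = x := by rw [Equiv.symm_apply_eq]; exact (hσM x hxi).symm
      rwa [this]
  have hnb : ∀ u, ((T.comap σ.symm).neighborSet u).ncard =
      (T.neighborSet (σ.symm u)).ncard := by
    intro u
    have : (T.comap σ.symm).neighborSet u = σ '' T.neighborSet (σ.symm u) := by
      ext x
      simp [SimpleGraph.mem_neighborSet, Equiv.image_eq_preimage_symm]
    rw [this, Set.ncard_image_of_injective _ σ.injective]
  intro l u hu v hv h2 h3
  rw [hnb] at h2 h3
  exact σ.symm.injective (hpoly l _ (hmemj l u hu) _ (hmemj l v hv) h2 h3)
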